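/- arXiv:1409.8446 — 4 statements merged into one kernel-verified Lean document; each statement's English description precedes it below -/
import Mathlib

section
/- Let 0 < α < 1, b > 0, and let f ∈ C¹[0,b] with f(0) = 0. Suppose g : [0,b] → ℝ is continuous and satisfies the Abel integral equation of first kind f(x) = ∫₀ˣ g(t)/(x−t)^α dt for all x ∈ [0,b]. Then for every x ∈ (0,b], g(x) = (sin(απ)/π) · ∫₀ˣ f′(t)/(x−t)^{1−α} dt. -/
open Real intervalIntegral Set

open MeasureTheory ProbabilityTheory

/-- The Riemann–Liouville integral of order `β` based at `0`, without its Gamma factor. -/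
noncomputable def rlIntegral (β : ℝ) (φ : ℝ → ℝ) (y : ℝ) : ℝ :=
  ∫ t in (0 : ℝ)..y, φ t * (y - t) ^ (β - 1)

theorem integral_rpow_mul_sub_rpow {β γ a : ℝ} (hβ : 0 < β) (hγ : 0 < γ) (ha : 0 < a) :
    ∫ x in (0 : ℝ)..a, x ^ (γ - 1) * (a - x) ^ (β - 1) = a ^ (β + γ - 1) * beta γ β := by
  have key := Complex.betaIntegral_scaled (γ : ℂ) (β : ℂ) ha
  have hbeta : Complex.betaIntegral (γ : ℂ) (β : ℂ) = ((beta γ β : ℝ) : ℂ) := by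
    rw [Complex.betaIntegral_eq_Gamma_mul_div _ _ (by simpa) (by simpa), beta,
      ← Complex.ofReal_add, Complex.Gamma_ofReal, Complex.Gamma_ofReal, Complex.Gamma_ofReal]
    push_cast
    rfl
  have hpow : (a : ℂ) ^ ((γ : ℂ) + β - 1) = ((a ^ (β + γ - 1) : ℝ) : ℂ) := by
    rw [Complex.ofReal_cpow ha.le]
    push_cast
    rw [add_comm (γ : ℂ)]
  rw [hbeta, hpow] at key
  apply Complex.ofReal_injective
  rw [← intervalIntegral.integral_ofReal, Complex.ofReal_mul, ← key]
  refine intervalIntegral.integral_congr fun x hx => ?_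
  rw [uIcc_of_le ha.le] at hx
  rw [Complex.ofReal_mul, Complex.ofReal_cpow hx.1, Complex.ofReal_cpow (sub_nonneg.2 hx.2)]
  push_cast
  rfl

/-- The truncated power `s ↦ s ^ (β - 1)` on `(0, ∞)`, extended by zero. -/
noncomputable def powKernel (β s : ℝ) : ℝ := (Ioi (0 : ℝ)).indicator (fun s => s ^ (β - 1)) s

theorem measurable_powKernel (β : ℝ) : Measurable (powKernel β) :=
  (measurable_id.pow_const (β - 1)).indicator measurableSet_Ioi

theorem powKernel_nonneg (β s : ℝ) : 0 ≤ powKernel β s :=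
  indicator_nonneg (fun _ hs => rpow_nonneg (le_of_lt hs) _) s

theorem powKernel_of_pos {β s : ℝ} (hs : 0 < s) : powKernel β s = s ^ (β - 1) :=
  indicator_of_mem (mem_Ioi.2 hs) _

theorem powKernel_of_nonpos {β s : ℝ} (hs : s ≤ 0) : powKernel β s = 0 :=
  indicator_of_notMem (notMem_Ioi.2 hs) _

theorem setIntegral_mul_powKernel (β : ℝ) (φ : ℝ → ℝ) {x y : ℝ} (hx : 0 ≤ x) (hxy : x ≤ y) :
    ∫ t in Ioo 0 y, φ t * powKernel β (x - t) = rlIntegral β φ x := by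
  rw [rlIntegral, intervalIntegral.integral_of_le hx, integral_Ioc_eq_integral_Ioo]
  rw [setIntegral_eq_of_subset_of_forall_sdiff_eq_zero measurableSet_Ioo
    (Ioo_subset_Ioo_right hxy)]
  · refine setIntegral_congr_fun measurableSet_Ioo fun t ht => ?_
    rw [powKernel_of_pos (sub_pos.2 ht.2)]
  · intro t ht
    have : x - t ≤ 0 := by
      by_contra! h
      exact ht.2 ⟨ht.1.1, sub_pos.1 h⟩
    rw [powKernel_of_nonpos this, mul_zero]

theorem setIntegral_powKernel_mul_powKernel {β γ t y : ℝ} (hβ : 0 < β) (hγ : 0 < γ)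
    (ht : 0 < t) (hty : t < y) :
    ∫ x in Ioo 0 y, powKernel γ (x - t) * powKernel β (y - x)
      = beta γ β * (y - t) ^ (β + γ - 1) := by
  rw [mul_comm, ← integral_rpow_mul_sub_rpow hβ hγ (sub_pos.2 hty)]
  have hsub := intervalIntegral.integral_comp_sub_right (a := t) (b := y)
    (fun x => x ^ (γ - 1) * ((y - t) - x) ^ (β - 1)) t
  rw [sub_self] at hsub
  rw [← hsub, intervalIntegral.integral_of_le hty.le, integral_Ioc_eq_integral_Ioo,
    setIntegral_eq_of_subset_of_forall_sdiff_eq_zero measurableSet_Ioo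
    (Ioo_subset_Ioo_left ht.le)]
  · refine setIntegral_congr_fun measurableSet_Ioo fun x hx => ?_
    rw [powKernel_of_pos (sub_pos.2 hx.1), powKernel_of_pos (sub_pos.2 hx.2),
      sub_sub_sub_cancel_right]
  · intro x hx
    have : x - t ≤ 0 := by
      by_contra! h
      exact hx.2 ⟨sub_pos.1 h, hx.1.2⟩
    rw [powKernel_of_nonpos this, zero_mul]

theorem intervalIntegrable_sub_rpow {β : ℝ} (hβ : 0 < β) (y : ℝ) :
    IntervalIntegrable (fun t => (y - t) ^ (β - 1)) volume 0 y := by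
  have h := (intervalIntegrable_rpow' (a := 0) (b := y) (r := β - 1) (by linarith)).comp_sub_left y
  simpa using h.symm

/-- Semigroup law for Riemann–Liouville integrals. -/
theorem rlIntegral_rlIntegral {β γ y : ℝ} (hβ : 0 < β) (hγ : 0 < γ) (hy : 0 ≤ y)
    {φ : ℝ → ℝ} (hφ : Continuous φ) :
    rlIntegral β (rlIntegral γ φ) y = beta γ β * rlIntegral (β + γ) φ y := by
  set F : ℝ → ℝ → ℝ := fun x t => φ t * (powKernel γ (x - t) * powKernel β (y - x)) with hF
  have hmeas : Measurable (Function.uncurry F) := by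
    have h1 := (measurable_powKernel γ).comp (measurable_fst.sub measurable_snd : Measurable
      fun p : ℝ × ℝ => p.1 - p.2)
    have h2 := (measurable_powKernel β).comp ((measurable_const (a := y)).sub measurable_fst :
      Measurable fun p : ℝ × ℝ => y - p.1)
    exact (hφ.measurable.comp measurable_snd).mul (h1.mul h2)
  have hsec : ∀ t ∈ Ioo 0 y, ∫ x in Ioo 0 y, ‖F x t‖
      = beta γ β * (|φ t| * (y - t) ^ (β + γ - 1)) := by
    intro t ht
    have : ∀ x, ‖F x t‖ = |φ t| * (powKernel γ (x - t) * powKernel β (y - x)) := fun x => by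
      rw [hF, norm_mul, norm_eq_abs, norm_of_nonneg
        (mul_nonneg (powKernel_nonneg _ _) (powKernel_nonneg _ _))]
    simp_rw [this]
    rw [MeasureTheory.integral_const_mul, setIntegral_powKernel_mul_powKernel hβ hγ ht.1 ht.2]
    ring
  have hint : Integrable (Function.uncurry F)
      ((volume.restrict (Ioo 0 y)).prod (volume.restrict (Ioo 0 y))) := by
    rw [integrable_prod_iff' hmeas.aestronglyMeasurable]
    constructor
    · filter_upwards [ae_restrict_mem measurableSet_Ioo] with t ht
      refine Integrable.const_mul (Integrable.of_integral_ne_zero ?_) (φ t)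
      rw [setIntegral_powKernel_mul_powKernel hβ hγ ht.1 ht.2]
      exact (mul_pos (beta_pos hγ hβ) (rpow_pos_of_pos (sub_pos.2 ht.2) _)).ne'
    · have h := ((intervalIntegrable_sub_rpow (add_pos hβ hγ) y).continuousOn_mul
        hφ.abs.continuousOn).const_mul (beta γ β)
      rw [intervalIntegrable_iff_integrableOn_Ioo_of_le hy] at h
      exact h.congr_fun (fun t ht => (hsec t ht).symm) measurableSet_Ioo
  calc rlIntegral β (rlIntegral γ φ) y
      = ∫ x in Ioo 0 y, ∫ t in Ioo 0 y, F x t := by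
        rw [← setIntegral_mul_powKernel β _ hy le_rfl]
        refine setIntegral_congr_fun measurableSet_Ioo fun x hx => ?_
        simp only [hF]
        rw [← setIntegral_mul_powKernel γ φ hx.1.le hx.2.le, ← MeasureTheory.integral_mul_const]
        simp_rw [mul_assoc]
    _ = ∫ t in Ioo 0 y, ∫ x in Ioo 0 y, F x t := integral_integral_swap hint
    _ = beta γ β * rlIntegral (β + γ) φ y := by
        rw [← setIntegral_mul_powKernel (β + γ) _ hy le_rfl, ← MeasureTheory.integral_const_mul]
        refine setIntegral_congr_fun measurableSet_Ioo fun t ht => ?_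
        simp only [hF]
        rw [MeasureTheory.integral_const_mul, setIntegral_powKernel_mul_powKernel hβ hγ ht.1 ht.2,
          powKernel_of_pos (sub_pos.2 ht.2)]
        ring

theorem beta_comm (β γ : ℝ) : beta β γ = beta γ β := by
  rw [beta, beta, mul_comm, add_comm]

theorem rlIntegral_one (φ : ℝ → ℝ) (y : ℝ) : rlIntegral 1 φ y = ∫ t in (0 : ℝ)..y, φ t := by
  simp [rlIntegral]

theorem rlIntegral_eq_rpow_mul {β y : ℝ} (hβ : 0 < β) (hy : 0 ≤ y) (φ : ℝ → ℝ) :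
    rlIntegral β φ y = y ^ β * ∫ u in (0 : ℝ)..1, φ (y * u) * (1 - u) ^ (β - 1) := by
  rcases hy.eq_or_lt with rfl | hy'
  · simp [rlIntegral, zero_rpow hβ.ne']
  have h := intervalIntegral.mul_integral_comp_mul_left (a := 0) (b := 1)
    (f := fun t => φ t * (y - t) ^ (β - 1)) y
  rw [mul_zero, mul_one] at h
  rw [rlIntegral, ← h, ← intervalIntegral.integral_const_mul,
    ← intervalIntegral.integral_const_mul]
  refine intervalIntegral.integral_congr fun u hu => ?_
  rw [uIcc_of_le zero_le_one] at hu
  rw [show y - y * u = y * (1 - u) by ring, mul_rpow hy (sub_nonneg.2 hu.2),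
    rpow_sub_one hy'.ne']
  field_simp

theorem continuousOn_rlIntegral {β : ℝ} (hβ : 0 < β) {φ : ℝ → ℝ} (hφ : Continuous φ) (b : ℝ) :
    ContinuousOn (rlIntegral β φ) (Icc 0 b) := by
  obtain ⟨M, hM⟩ := isCompact_Icc.exists_bound_of_continuousOn (s := Icc 0 b) hφ.continuousOn
  have hkey : ContinuousOn (fun y => ∫ u in (0 : ℝ)..1, φ (y * u) * (1 - u) ^ (β - 1))
      (Icc 0 b) := by
    intro y₀ _
    refine intervalIntegral.continuousWithinAt_of_dominated_interval
      (bound := fun u => M * (1 - u) ^ (β - 1)) (.of_forall fun y => ?_) ?_ ?_ ?_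
    · have h : Measurable fun u : ℝ => φ (y * u) * (1 - u) ^ (β - 1) :=
        (hφ.measurable.comp (measurable_const.mul measurable_id)).mul
          ((measurable_const.sub measurable_id).pow_const _)
      exact h.aestronglyMeasurable
    · filter_upwards [self_mem_nhdsWithin] with y hy
      refine .of_forall fun u hu => ?_
      rw [uIoc_of_le zero_le_one] at hu
      have hp : 0 ≤ (1 - u) ^ (β - 1) := rpow_nonneg (sub_nonneg.2 hu.2) _
      rw [norm_mul, norm_of_nonneg hp]
      exact mul_le_mul_of_nonneg_right (hM _ ⟨mul_nonneg hy.1 hu.1.le,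
        (mul_le_of_le_one_right hy.1 hu.2).trans hy.2⟩) hp
    · exact (intervalIntegrable_sub_rpow hβ 1).const_mul M
    · exact .of_forall fun u _ => by fun_prop
  refine ((continuous_id.rpow_const fun _ => Or.inr hβ.le).continuousOn.mul hkey).congr ?_
  exact fun y hy => rlIntegral_eq_rpow_mul hβ hy.1 φ

theorem eqOn_of_integral_eq {b : ℝ} (hb : 0 < b) {φ ψ : ℝ → ℝ} (hφ : ContinuousOn φ (Icc 0 b))
    (hψ : ContinuousOn ψ (Icc 0 b))
    (h : ∀ y ∈ Icc 0 b, ∫ t in (0 : ℝ)..y, φ t = ∫ t in (0 : ℝ)..y, ψ t) :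
    EqOn φ ψ (Icc 0 b) := by
  have hd : ∀ χ : ℝ → ℝ, ContinuousOn χ (Icc 0 b) → ∀ x ∈ Icc 0 b,
      HasDerivWithinAt (fun y => ∫ t in (0 : ℝ)..y, χ t) (χ x) (Icc 0 b) x := by
    intro χ hχ x hx
    have := Fact.mk hx
    refine intervalIntegral.integral_hasDerivWithinAt_right ?_ ?_ (hχ x hx)
    · exact (hχ.mono (by rw [uIcc_of_le hx.1]; exact Icc_subset_Icc_right hx.2)).intervalIntegrable
    · exact hχ.stronglyMeasurableAtFilter_nhdsWithin measurableSet_Icc x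
  intro x hx
  exact (uniqueDiffOn_Icc hb x hx).eq_deriv _ (hd φ hφ x hx)
    ((hd ψ hψ x hx).congr (fun y hy => h y hy) (h x hx))

theorem beta_one_sub (α : ℝ) : beta (1 - α) α = π / sin (α * π) := by
  rw [beta, sub_add_cancel, Gamma_one, div_one, mul_comm, Real.Gamma_mul_Gamma_one_sub,
    mul_comm π]

/-- If `0 < α < 1`, `b > 0`, `f ∈ C¹[0,b]` with `f 0 = 0`, and a continuous
`g` satisfies the Abel integral equation of first kind
`f x = ∫ t in 0..x, g t / (x - t) ^ α` for all `x ∈ [0,b]`, then for every `x ∈ (0,b]`,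
`g x = (sin (α π) / π) * ∫ t in 0..x, f' t / (x - t) ^ (1 - α)`. -/
theorem abel_solution_necessity
    (α b : ℝ) (hα0 : 0 < α) (hα1 : α < 1) (hb : 0 < b)
    (f f' g : ℝ → ℝ)
    (hf : ∀ t ∈ Set.Icc (0 : ℝ) b, HasDerivWithinAt f (f' t) (Set.Icc (0 : ℝ) b) t)
    (hf' : ContinuousOn f' (Set.Icc (0 : ℝ) b))
    (hf0 : f 0 = 0)
    (hg : ContinuousOn g (Set.Icc (0 : ℝ) b))
    (habel : ∀ x ∈ Set.Icc (0 : ℝ) b, f x = ∫ t in (0 : ℝ)..x, g t / (x - t) ^ α) :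
    ∀ x ∈ Set.Ioc (0 : ℝ) b,
      g x = Real.sin (α * π) / π * ∫ t in (0 : ℝ)..x, f' t / (x - t) ^ (1 - α) := by
  have hle := hb.le
  set G : ℝ → ℝ := IccExtend hle ((Icc 0 b).domRestrict g)
  set D : ℝ → ℝ := IccExtend hle ((Icc 0 b).domRestrict f')
  have hG : Continuous G := (continuousOn_iff_continuous_domRestrict.1 hg).Icc_extend'
  have hD : Continuous D := (continuousOn_iff_continuous_domRestrict.1 hf').Icc_extend'
  have hGg : EqOn G g (Icc 0 b) := fun t ht => IccExtend_of_mem hle _ ht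
  have hDf : EqOn D f' (Icc 0 b) := fun t ht => IccExtend_of_mem hle _ ht
  have hsub : ∀ {x}, x ∈ Icc 0 b → uIcc 0 x ⊆ Icc 0 b := fun hx => by
    rw [uIcc_of_le hx.1]
    exact Icc_subset_Icc_right hx.2
  have hfG : EqOn f (rlIntegral (1 - α) G) (Icc 0 b) := by
    intro x hx
    rw [habel x hx]
    refine intervalIntegral.integral_congr fun t ht => ?_
    have htx : t ≤ x := by rw [uIcc_of_le hx.1] at ht; exact ht.2
    rw [hGg (hsub hx ht), show 1 - α - 1 = -α by ring, rpow_neg (sub_nonneg.2 htx),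
      div_eq_mul_inv]
  have hfD : EqOn f (rlIntegral 1 D) (Icc 0 b) := by
    intro x hx
    rw [rlIntegral_one, intervalIntegral.integral_eq_sub_of_hasDerivAt_of_le (f := f) hx.1, hf0,
      sub_zero]
    · exact fun t ht => ((hf t ⟨ht.1, ht.2.trans hx.2⟩).mono
        (Icc_subset_Icc_right hx.2)).continuousWithinAt
    · intro t ht
      have htb : t ∈ Ioo 0 b := ⟨ht.1, ht.2.trans_le hx.2⟩
      rw [hDf (Ioo_subset_Icc_self htb)]
      exact (hf t (Ioo_subset_Icc_self htb)).hasDerivAt (Icc_mem_nhds htb.1 htb.2)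
    · exact hD.intervalIntegrable _ _
  have hEq : ∀ y ∈ Icc 0 b, ∫ t in (0 : ℝ)..y, beta (1 - α) α * G t
      = ∫ t in (0 : ℝ)..y, rlIntegral α D t := by
    intro y hy
    have h1 : rlIntegral α (rlIntegral (1 - α) G) y = rlIntegral α (rlIntegral 1 D) y :=
      intervalIntegral.integral_congr fun t ht => by
        rw [← hfG (hsub hy ht), ← hfD (hsub hy ht)]
    rw [rlIntegral_rlIntegral hα0 (sub_pos.2 hα1) hy.1 hG,
      rlIntegral_rlIntegral hα0 one_pos hy.1 hD, beta_comm 1 α, add_comm α 1,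
      ← rlIntegral_rlIntegral one_pos hα0 hy.1 hD, add_sub_cancel, rlIntegral_one,
      rlIntegral_one] at h1
    rw [intervalIntegral.integral_const_mul, h1]
  intro x hx
  have hxI := Ioc_subset_Icc_self hx
  have hval : beta (1 - α) α * G x = rlIntegral α D x :=
    eqOn_of_integral_eq hb (continuousOn_const.mul hG.continuousOn)
    (continuousOn_rlIntegral hα0 hD b) hEq hxI
  have hH : rlIntegral α D x = ∫ t in (0 : ℝ)..x, f' t / (x - t) ^ (1 - α) := by
    refine intervalIntegral.integral_congr fun t ht => ?_
    have htx : t ≤ x := by rw [uIcc_of_le hx.1.le] at ht; exact ht.2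
    rw [hDf (hsub hxI ht), show α - 1 = -(1 - α) by ring, rpow_neg (sub_nonneg.2 htx),
      div_eq_mul_inv]
  have hsin : 0 < sin (α * π) :=
    sin_pos_of_pos_of_lt_pi (mul_pos hα0 pi_pos) (by nlinarith [pi_pos])
  rw [← hH, ← hval, beta_one_sub, hGg hxI]
  field_simp
end

section
/- Let 0 < α < 1, b > 0, and let f ∈ C¹[0,b] with f(0) = 0. Define g(x) = (sin(απ)/π) · ∫₀ˣ f′(t)/(x−t)^{1−α} dt for x ∈ (0,b] and g(0) = 0. Then g satisfies the Abel integral equation of first kind: for every x ∈ [0,b], ∫₀ˣ g(t)/(x−t)^α dt = f(x). -/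
open Real intervalIntegral Set

/-- The Beta integral `B(α, 1 - α)`, evaluated on `[0, a]` through the reflection formula. -/
lemma integral_rpow_mul_sub_rpow_s1 {α a : ℝ} (hα0 : 0 < α) (hα1 : α < 1) (ha : 0 < a) :
    ∫ y in (0 : ℝ)..a, y ^ (α - 1) * (a - y) ^ (-α) = π / Real.sin (π * α) := by
  have h1 : Complex.betaIntegral α (1 - α : ℂ) = π / Complex.sin (π * α) := by
    have h := Complex.Gamma_mul_Gamma_eq_betaIntegral (s := α) (t := 1 - α)
      (by simpa using hα0) (by simpa using hα1)
    rw [Complex.Gamma_mul_Gamma_one_sub, add_sub_cancel, Complex.Gamma_one, one_mul] at h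
    exact h.symm
  have h2 := Complex.betaIntegral_scaled (α : ℂ) (1 - α : ℂ) ha
  rw [add_sub_cancel, sub_self, Complex.cpow_zero, one_mul, h1] at h2
  apply Complex.ofReal_injective
  rw [← intervalIntegral.integral_ofReal]
  push_cast
  rw [← h2]
  refine intervalIntegral.integral_congr fun y hy => ?_
  rw [uIcc_of_le ha.le] at hy
  rw [Complex.ofReal_cpow hy.1, Complex.ofReal_cpow (sub_nonneg.2 hy.2)]
  push_cast
  congr 2
  ring

lemma setIntegral_sub_rpow_mul_sub_rpow {α s x : ℝ} (hα0 : 0 < α) (hα1 : α < 1) (hsx : s < x) :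
    ∫ t in Ioo s x, (t - s) ^ (α - 1) * (x - t) ^ (-α) = π / Real.sin (π * α) := by
  rw [← MeasureTheory.integral_Ioc_eq_integral_Ioo, ← intervalIntegral.integral_of_le hsx.le]
  have h := intervalIntegral.integral_comp_sub_right (a := s) (b := x)
    (fun y : ℝ => y ^ (α - 1) * ((x - s) - y) ^ (-α)) s
  rw [sub_self, integral_rpow_mul_sub_rpow_s1 hα0 hα1 (sub_pos.2 hsx)] at h
  simpa using h

/-- The kernel `(t - s) ^ (α - 1) * (x - t) ^ (-α)`, restricted to `s < t`. -/
noncomputable def abelKernel (α x t s : ℝ) : ℝ :=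
  (Ioi s).indicator (fun t => (t - s) ^ (α - 1) * (x - t) ^ (-α)) t

lemma measurable_abelKernel (α x : ℝ) :
    Measurable fun p : ℝ × ℝ => abelKernel α x p.1 p.2 := by
  have h : (fun p : ℝ × ℝ => abelKernel α x p.1 p.2) =
      {p : ℝ × ℝ | p.2 < p.1}.indicator
        fun p => (p.1 - p.2) ^ (α - 1) * (x - p.1) ^ (-α) := by
    ext p
    simp [abelKernel, indicator_apply]
  rw [h]
  exact Measurable.indicator (by fun_prop) (measurableSet_lt measurable_snd measurable_fst)

lemma abelKernel_nonneg {α x t s : ℝ} (ht : t ≤ x) : 0 ≤ abelKernel α x t s := by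
  refine indicator_apply_nonneg fun hst => ?_
  have h1 : 0 ≤ t - s := sub_nonneg.2 (le_of_lt hst)
  have h2 : 0 ≤ x - t := sub_nonneg.2 ht
  positivity

lemma integral_abelKernel {α x s : ℝ} (hα0 : 0 < α) (hα1 : α < 1) (hs : s ∈ Ioo 0 x) :
    ∫ t in Ioo 0 x, abelKernel α x t s = π / Real.sin (π * α) := by
  have hset : Ioo 0 x ∩ Ioi s = Ioo s x := by
    ext t
    simp only [mem_inter_iff, mem_Ioo, mem_Ioi]
    constructor
    · rintro ⟨⟨_, h⟩, h'⟩
      exact ⟨h', h⟩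
    · rintro ⟨h', h⟩
      exact ⟨⟨hs.1.trans h', h⟩, h'⟩
  unfold abelKernel
  rw [MeasureTheory.setIntegral_indicator measurableSet_Ioi, hset,
    setIntegral_sub_rpow_mul_sub_rpow hα0 hα1 hs.2]

lemma pi_div_sin_pos {α : ℝ} (hα0 : 0 < α) (hα1 : α < 1) : 0 < π / Real.sin (π * α) :=
  div_pos pi_pos (sin_pos_of_pos_of_lt_pi (by positivity) (by nlinarith [pi_pos]))

lemma integrable_mul_abelKernel {α x : ℝ} {h : ℝ → ℝ} (hα0 : 0 < α) (hα1 : α < 1)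
    (hh : MeasureTheory.IntegrableOn h (Ioo 0 x)) :
    MeasureTheory.Integrable (Function.uncurry fun t s => h s * abelKernel α x t s)
      ((MeasureTheory.volume.restrict (Ioo 0 x)).prod
        (MeasureTheory.volume.restrict (Ioo 0 x))) := by
  have hmeas : MeasureTheory.AEStronglyMeasurable
      (Function.uncurry fun t s => h s * abelKernel α x t s)
      ((MeasureTheory.volume.restrict (Ioo 0 x)).prod
        (MeasureTheory.volume.restrict (Ioo 0 x))) :=
    hh.aestronglyMeasurable.comp_snd.mul (measurable_abelKernel α x).aestronglyMeasurable
  rw [MeasureTheory.integrable_prod_iff' hmeas]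
  constructor
  · filter_upwards [MeasureTheory.ae_restrict_mem measurableSet_Ioo] with s hs
    refine MeasureTheory.Integrable.const_mul ?_ (h s)
    apply MeasureTheory.Integrable.of_integral_ne_zero
    rw [integral_abelKernel hα0 hα1 hs]
    exact (pi_div_sin_pos hα0 hα1).ne'
  · refine (hh.norm.mul_const (π / Real.sin (π * α))).congr ?_
    filter_upwards [MeasureTheory.ae_restrict_mem measurableSet_Ioo] with s hs
    rw [← integral_abelKernel hα0 hα1 hs, ← MeasureTheory.integral_const_mul]
    refine MeasureTheory.setIntegral_congr_fun measurableSet_Ioo fun t ht => ?_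
    simp only [Function.uncurry_apply_pair]
    rw [norm_mul, Real.norm_of_nonneg (abelKernel_nonneg ht.2.le)]

lemma integral_mul_abelKernel_right {α x t : ℝ} (h : ℝ → ℝ) (ht : t ∈ Ioo 0 x) :
    ∫ s in Ioo 0 x, h s * abelKernel α x t s =
      (∫ s in (0 : ℝ)..t, h s / (t - s) ^ (1 - α)) / (x - t) ^ α := by
  have hset : Ioo 0 x ∩ Iio t = Ioo 0 t := by
    rw [Ioo_inter_Iio, min_eq_right ht.2.le]
  have hind : (fun s => h s * abelKernel α x t s) =
      (Iio t).indicator fun s => h s * ((t - s) ^ (α - 1) * (x - t) ^ (-α)) := by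
    ext s
    simp [abelKernel, indicator_apply]
  rw [hind, MeasureTheory.setIntegral_indicator measurableSet_Iio, hset,
    intervalIntegral.integral_of_le ht.1.le, MeasureTheory.integral_Ioc_eq_integral_Ioo,
    ← MeasureTheory.integral_div]
  refine MeasureTheory.setIntegral_congr_fun measurableSet_Ioo fun s hs => ?_
  rw [← neg_sub 1 α, rpow_neg (sub_nonneg.2 hs.2.le), rpow_neg (sub_nonneg.2 ht.2.le)]
  simp only [div_eq_mul_inv, mul_assoc]

/-- Composing the two Abel kernels integrates `h`, up to the factor `π / sin (π α)`. -/
lemma integral_abel_comp {α x : ℝ} {h : ℝ → ℝ} (hα0 : 0 < α) (hα1 : α < 1)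
    (hh : MeasureTheory.IntegrableOn h (Ioo 0 x)) :
    ∫ t in Ioo 0 x, (∫ s in (0 : ℝ)..t, h s / (t - s) ^ (1 - α)) / (x - t) ^ α =
      π / Real.sin (π * α) * ∫ s in Ioo 0 x, h s := by
  calc
    _ = ∫ t in Ioo 0 x, ∫ s in Ioo 0 x, h s * abelKernel α x t s :=
      MeasureTheory.setIntegral_congr_fun measurableSet_Ioo fun t ht =>
        (integral_mul_abelKernel_right h ht).symm
    _ = ∫ s in Ioo 0 x, ∫ t in Ioo 0 x, h s * abelKernel α x t s :=
      MeasureTheory.integral_integral_swap (integrable_mul_abelKernel hα0 hα1 hh)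
    _ = ∫ s in Ioo 0 x, π / Real.sin (π * α) * h s := by
      refine MeasureTheory.setIntegral_congr_fun measurableSet_Ioo fun s hs => ?_
      rw [MeasureTheory.integral_const_mul, integral_abelKernel hα0 hα1 hs, mul_comm]
    _ = _ := MeasureTheory.integral_const_mul _ _

/-- If `0 < α < 1`, `b > 0`, `f ∈ C¹[0,b]` with `f 0 = 0`, and `g` is defined by
`g x = (sin (α π) / π) * ∫ t in 0..x, f' t / (x - t) ^ (1 - α)` for `x ∈ (0,b]` with `g 0 = 0`,
then `g` satisfies the Abel integral equation of first kind:
`∫ t in 0..x, g t / (x - t) ^ α = f x` for every `x ∈ [0,b]`. -/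
theorem abel_solution_sufficiency
    (α b : ℝ) (hα0 : 0 < α) (hα1 : α < 1) (hb : 0 < b)
    (f f' g : ℝ → ℝ)
    (hf : ∀ t ∈ Set.Icc (0 : ℝ) b, HasDerivWithinAt f (f' t) (Set.Icc (0 : ℝ) b) t)
    (hf' : ContinuousOn f' (Set.Icc (0 : ℝ) b))
    (hf0 : f 0 = 0)
    (hg0 : g 0 = 0)
    (hg : ∀ x ∈ Set.Ioc (0 : ℝ) b,
      g x = Real.sin (α * π) / π * ∫ t in (0 : ℝ)..x, f' t / (x - t) ^ (1 - α)) :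
    ∀ x ∈ Set.Icc (0 : ℝ) b, (∫ t in (0 : ℝ)..x, g t / (x - t) ^ α) = f x := by
  intro x hx
  rcases hx.1.eq_or_lt with rfl | hx0
  · simp [hf0]
  have hsub : Icc 0 x ⊆ Icc 0 b := Icc_subset_Icc_right hx.2
  have hint : IntervalIntegrable f' MeasureTheory.volume 0 x :=
    (hf'.mono hsub).intervalIntegrable_of_Icc hx0.le
  have hint' : MeasureTheory.IntegrableOn f' (Ioo 0 x) :=
    ((intervalIntegrable_iff_integrableOn_Ioc_of_le hx0.le).1 hint).mono_set Ioo_subset_Ioc_self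
  have hftc : ∫ s in Ioo 0 x, f' s = f x := by
    rw [← MeasureTheory.integral_Ioc_eq_integral_Ioo, ← intervalIntegral.integral_of_le hx0.le,
      intervalIntegral.integral_eq_sub_of_hasDerivAt_of_le hx0.le
        (fun t ht => ((hf t (hsub ht)).continuousWithinAt.mono hsub))
        (fun t ht => (hf t (hsub (Ioo_subset_Icc_self ht))).hasDerivAt
          (Icc_mem_nhds ht.1 (ht.2.trans_le hx.2))) hint, hf0, sub_zero]
  have hsin : Real.sin (π * α) ≠ 0 := fun h0 => by
    simpa [h0] using pi_div_sin_pos hα0 hα1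
  rw [intervalIntegral.integral_of_le hx0.le, MeasureTheory.integral_Ioc_eq_integral_Ioo]
  calc
    _ = ∫ t in Ioo 0 x, Real.sin (α * π) / π *
        ((∫ s in (0 : ℝ)..t, f' s / (t - s) ^ (1 - α)) / (x - t) ^ α) := by
      refine MeasureTheory.setIntegral_congr_fun measurableSet_Ioo fun t ht => ?_
      rw [hg t ⟨ht.1, ht.2.le.trans hx.2⟩, mul_div_assoc]
    _ = f x := by
      rw [MeasureTheory.integral_const_mul, integral_abel_comp hα0 hα1 hint', hftc, mul_comm α π]
      field_simp
end

section
/- Let α > 0 and b > 0. There exists a constant c′_α > 0, depending only on α, with the following property: for every k ∈ ℕ, k ≥ 1, setting h = b/k and nodes x_j = j·h for j = 0, …, k, and for every f ∈ C²[0,b], the modified trapezoidal rule T(f,h,α) = (h^α/Γ(α+2)) · [ ((k−1)^{α+1} − (k−α−1)·k^α)·f(0) + f(b) + Σ_{j=1}^{k−1} ((k−j+1)^{α+1} − 2(k−j)^{α+1} + (k−j−1)^{α+1})·f(x_j) ] satisfies | (1/Γ(α)) ∫₀ᵇ (b−t)^{α−1} f(t) dt − T(f,h,α) | ≤ c′_α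 · ‖f″‖_∞ · b^α · h², where ‖f″‖_∞ = max_{t∈[0,b]} |f″(t)|. -/
open Real intervalIntegral Set

lemma intervalIntegrable_sub_rpow_mul {α b p q : ℝ} (hα : 0 < α) {g : ℝ → ℝ}
    (hg : ContinuousOn g (Set.uIcc p q)) :
    IntervalIntegrable (fun t => (b - t) ^ (α - 1) * g t) MeasureTheory.volume p q := by
  have h1 : IntervalIntegrable (fun x : ℝ => x ^ (α - 1)) MeasureTheory.volume (b - p) (b - q) :=
    intervalIntegral.intervalIntegrable_rpow' (by linarith)
  have h2 := h1.comp_sub_left b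
  simp only [sub_sub_cancel] at h2
  exact h2.mul_continuousOn hg

/-- The Riemann–Liouville kernel integrated against an affine function of `b - t`. -/
lemma integral_sub_rpow_mul_affine {α b p q c d : ℝ} (hα : 0 < α) (hpq : p ≤ q) (hqb : q ≤ b) :
    ∫ t in p..q, (b - t) ^ (α - 1) * (c + d * (b - t)) =
      c * (((b - p) ^ α - (b - q) ^ α) / α) +
        d * (((b - p) ^ (α + 1) - (b - q) ^ (α + 1)) / (α + 1)) := by
  rw [intervalIntegral.integral_comp_sub_left (fun u => u ^ (α - 1) * (c + d * u)) b]
  have h : ∫ u in (b - q)..(b - p), u ^ (α - 1) * (c + d * u) =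
      ∫ u in (b - q)..(b - p), (c * u ^ (α - 1) + d * u ^ α) := by
    refine intervalIntegral.integral_congr fun u hu => ?_
    rw [Set.uIcc_of_le (by linarith)] at hu
    have hu0 : 0 ≤ u := by linarith [hu.1]
    have h1 : u ^ α = u ^ (α - 1) * u := by
      rw [← Real.rpow_add_one' hu0 (by simpa using hα.ne'), sub_add_cancel]
    simp only [h1]
    ring
  rw [h, intervalIntegral.integral_add, intervalIntegral.integral_const_mul,
    intervalIntegral.integral_const_mul, integral_rpow (Or.inl (by linarith)),
    integral_rpow (Or.inl (by linarith)), sub_add_cancel]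
  · exact (intervalIntegral.intervalIntegrable_rpow' (by linarith)).const_mul c
  · exact (intervalIntegral.intervalIntegrable_rpow' (by linarith)).const_mul d

lemma integral_sub_rpow {α b p q : ℝ} (hα : 0 < α) (hpq : p ≤ q) (hqb : q ≤ b) :
    ∫ t in p..q, (b - t) ^ (α - 1) = ((b - p) ^ α - (b - q) ^ α) / α := by
  simpa using integral_sub_rpow_mul_affine (c := 1) (d := 0) hα hpq hqb

/-- The error of linear interpolation of a `C¹` function with `M`-Lipschitz derivative. -/
lemma abs_sub_linear_interpolation_le {f f' : ℝ → ℝ} {p q M : ℝ} (hpq : p < q)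
    (hf : ContinuousOn f (Set.Icc p q)) (hf' : ∀ t ∈ Set.Ioo p q, HasDerivAt f (f' t) t)
    (hM : ∀ s ∈ Set.Icc p q, ∀ t ∈ Set.Icc p q, |f' s - f' t| ≤ M * |s - t|) (hM0 : 0 ≤ M)
    {t : ℝ} (ht : t ∈ Set.Icc p q) :
    |f t - (f p * (q - t) + f q * (t - p)) / (q - p)| ≤ M * (q - p) ^ 2 := by
  have hqp : 0 < q - p := sub_pos.2 hpq
  rcases ht.1.eq_or_lt with rfl | hpt
  · have : f p - (f p * (q - p) + f q * (p - p)) / (q - p) = 0 := by field_simp; ring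
    rw [this, abs_zero]; positivity
  obtain ⟨ξ, hξ, hξe⟩ := exists_hasDerivAt_eq_slope f f' hpt
    (hf.mono (Set.Icc_subset_Icc_right ht.2)) fun x hx => hf' x ⟨hx.1, hx.2.trans_le ht.2⟩
  obtain ⟨η, hη, hηe⟩ := exists_hasDerivAt_eq_slope f f' hpq hf hf'
  have htp : 0 < t - p := sub_pos.2 hpt
  have key : f t - (f p * (q - t) + f q * (t - p)) / (q - p) = (f' ξ - f' η) * (t - p) := by
    rw [hξe, hηe]; field_simp; ring
  have hξ' : ξ ∈ Set.Icc p q := ⟨hξ.1.le, hξ.2.le.trans ht.2⟩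
  have hη' : η ∈ Set.Icc p q := ⟨hη.1.le, hη.2.le⟩
  have hd : |ξ - η| ≤ q - p := abs_sub_le_iff.2
    ⟨by linarith [hξ'.2, hη'.1], by linarith [hη'.2, hξ'.1]⟩
  rw [key, abs_mul, abs_of_pos htp]
  calc |f' ξ - f' η| * (t - p) ≤ (M * (q - p)) * (q - p) := by
        refine mul_le_mul ((hM ξ hξ' η hη').trans (by gcongr)) (by linarith [ht.2]) htp.le
          (by positivity)
    _ = M * (q - p) ^ 2 := by ring

/-- The error of product integration with linear interpolation on a single panel. -/
lemma abs_integral_sub_rpow_mul_sub_interpolation_le {α b p q M : ℝ} {f f' : ℝ → ℝ} (hα : 0 < α)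
    (hpq : p < q) (hqb : q ≤ b)
    (hf : ContinuousOn f (Set.Icc p q)) (hf' : ∀ t ∈ Set.Ioo p q, HasDerivAt f (f' t) t)
    (hM : ∀ s ∈ Set.Icc p q, ∀ t ∈ Set.Icc p q, |f' s - f' t| ≤ M * |s - t|) (hM0 : 0 ≤ M) :
    |(∫ t in p..q, (b - t) ^ (α - 1) * f t) -
        ∫ t in p..q, (b - t) ^ (α - 1) * ((f p * (q - t) + f q * (t - p)) / (q - p))| ≤
      M * (q - p) ^ 2 * ∫ t in p..q, (b - t) ^ (α - 1) := by
  rw [← intervalIntegral.integral_sub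
    (intervalIntegrable_sub_rpow_mul hα (by rwa [Set.uIcc_of_le hpq.le]))
    (intervalIntegrable_sub_rpow_mul hα (by fun_prop)), ← intervalIntegral.integral_const_mul,
    ← Real.norm_eq_abs]
  refine intervalIntegral.norm_integral_le_of_norm_le hpq.le (.of_forall fun t ht => ?_) ?_
  · have hbt : 0 ≤ (b - t) ^ (α - 1) := Real.rpow_nonneg (by linarith [ht.2]) _
    rw [← mul_sub, Real.norm_eq_abs, abs_mul, abs_of_nonneg hbt, mul_comm]
    exact mul_le_mul_of_nonneg_right
      (abs_sub_linear_interpolation_le hpq hf hf' hM hM0 ⟨ht.1.le, ht.2⟩) hbt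
  · have := intervalIntegrable_sub_rpow_mul (α := α) (b := b) (p := p) (q := q) hα
      (g := fun _ => M * (q - p) ^ 2) continuousOn_const
    simpa only [mul_comm] using this

/-- The integral of the kernel against the linear interpolant on the panel of length `h`
whose endpoints lie at distance `m * h` and `(m - 1) * h` from `b`. -/
lemma integral_sub_rpow_mul_interpolation {α b p h m y z : ℝ} (hα : 0 < α) (hh : 0 < h)
    (hm : 1 ≤ m) (hp : b - p = m * h) :
    ∫ t in p..(p + h), (b - t) ^ (α - 1) * ((y * (p + h - t) + z * (t - p)) / h) =
      h ^ α / (α * (α + 1)) *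
        (((m - 1) ^ (α + 1) - (m - α - 1) * m ^ α) * y +
          (m ^ (α + 1) - (α + 1) * m * (m - 1) ^ α + α * (m - 1) ^ (α + 1)) * z) := by
  have hq : b - (p + h) = (m - 1) * h := by linarith
  have hm1 : 0 ≤ m - 1 := by linarith
  have hm0 : 0 ≤ m := by linarith
  have haff : ∀ t, (y * (p + h - t) + z * (t - p)) / h =
      (z * m - y * (m - 1)) + (y - z) / h * (b - t) := by
    intro t
    have : b = p + m * h := by linarith
    subst this
    field_simp
    ring
  simp only [haff]
  have hα1 : α + 1 ≠ 0 := by positivity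
  rw [integral_sub_rpow_mul_affine hα (by linarith)
    (by linarith [mul_nonneg hm1 hh.le]), hp, hq, Real.mul_rpow hm0 hh.le,
    Real.mul_rpow hm1 hh.le, Real.mul_rpow hm0 hh.le, Real.mul_rpow hm1 hh.le,
    Real.rpow_add_one' hm0 hα1, Real.rpow_add_one' hm1 hα1, Real.rpow_add_one' hh.le hα1]
  field_simp
  ring

/-- Collecting nodal contributions of the panels into the modified trapezoidal weights. -/
lemma sum_panel_weights {α : ℝ} (hα : 0 < α) {k : ℕ} (hk : 1 ≤ k) (F : ℕ → ℝ) :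
    ∑ j ∈ Finset.range k,
      ((((k : ℝ) - j - 1) ^ (α + 1) - ((k : ℝ) - j - α - 1) * ((k : ℝ) - j) ^ α) * F j +
        (((k : ℝ) - j) ^ (α + 1) - (α + 1) * ((k : ℝ) - j) * ((k : ℝ) - j - 1) ^ α +
          α * ((k : ℝ) - j - 1) ^ (α + 1)) * F (j + 1)) =
      ((((k : ℝ) - 1) ^ (α + 1) - ((k : ℝ) - α - 1) * (k : ℝ) ^ α) * F 0 + F k) +
        ∑ j ∈ Finset.Icc 1 (k - 1),
          (((k : ℝ) - (j : ℝ) + 1) ^ (α + 1) - 2 * ((k : ℝ) - (j : ℝ)) ^ (α + 1) +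
            ((k : ℝ) - (j : ℝ) - 1) ^ (α + 1)) * F j := by
  obtain ⟨n, rfl⟩ : ∃ n, k = n + 1 := ⟨k - 1, by omega⟩
  have hα1 : α + 1 ≠ 0 := by positivity
  have hIcc : Finset.Icc 1 (n + 1 - 1) = Finset.Ico (0 + 1) (n + 1) := by
    ext j; simp only [Finset.mem_Icc, Finset.mem_Ico]; omega
  rw [hIcc, ← Finset.sum_Ico_add' _ 0 n 1, ← Finset.range_eq_Ico, Finset.sum_add_distrib,
    Finset.sum_range_succ', Finset.sum_range_succ _ n]
  have hsum : ∀ a b c d e g : ℝ, a + c = e → b + d = g → (a + b) + (c + d) = g + e := by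
    intros; linarith
  apply hsum
  · rw [← Finset.sum_add_distrib]
    refine Finset.sum_congr rfl fun j hj => ?_
    have hj : (j : ℝ) + 1 ≤ n := by exact_mod_cast Finset.mem_range.1 hj
    push_cast
    rw [show (n : ℝ) + 1 - (j + 1) = n - j by ring, show (n : ℝ) + 1 - j = n - j + 1 by ring,
      add_sub_cancel_right, Real.rpow_add_one' (show (0 : ℝ) ≤ n - j by linarith) hα1]
    ring
  · push_cast
    simp [Real.zero_rpow hα1, Real.zero_rpow hα.ne']

lemma abs_derivWithin_sub_le_of_contDiffOn {b : ℝ} {f : ℝ → ℝ} (hb : 0 < b)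
    (hf : ContDiffOn ℝ 2 f (Set.Icc 0 b)) :
    ∀ s ∈ Set.Icc 0 b, ∀ t ∈ Set.Icc 0 b,
      |derivWithin f (Set.Icc 0 b) s - derivWithin f (Set.Icc 0 b) t| ≤
        sSup ((fun t => |iteratedDerivWithin 2 f (Set.Icc 0 b) t|) '' Set.Icc 0 b) * |s - t| := by
  intro s hs t ht
  have hu := uniqueDiffOn_Icc hb
  have hbdd : BddAbove ((fun t => |iteratedDerivWithin 2 f (Set.Icc 0 b) t|) '' Set.Icc 0 b) :=
    isCompact_Icc.bddAbove_image (hf.continuousOn_iteratedDerivWithin (by norm_num) hu).abs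
  have hdiff : DifferentiableOn ℝ (derivWithin f (Set.Icc 0 b)) (Set.Icc 0 b) :=
    (hf.derivWithin hu (m := 1) (by norm_num)).differentiableOn (by norm_num)
  refine (convex_Icc 0 b).norm_image_sub_le_of_norm_derivWithin_le hdiff (fun x hx => ?_) ht hs
  have h2 : iteratedDerivWithin 2 f (Set.Icc 0 b) x =
      derivWithin (derivWithin f (Set.Icc 0 b)) (Set.Icc 0 b) x := by
    rw [show (2 : ℕ) = 1 + 1 from rfl, iteratedDerivWithin_succ, iteratedDerivWithin_one]
  rw [← h2]
  exact le_csSup hbdd ⟨x, hx, rfl⟩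

/-- (Odibat's modified trapezoidal rule for the Riemann–Liouville fractional
integral.) Let `α > 0`. There is a constant `c > 0`, depending only on `α`, such that for
every `b > 0`, every `k ≥ 1` (with step `h = b/k` and nodes `x_j = j*h`), and every
`f ∈ C²[0,b]`, the modified trapezoidal rule `T(f,h,α)` approximates
`(1/Γ α) ∫ t in 0..b, (b - t)^(α-1) * f t` with error at most
`c * ‖f''‖_∞ * b^α * h²`. -/
theorem modified_trapezoidal_rule_fractional_integral
    (α : ℝ) (hα : 0 < α) :
    ∃ c > 0, ∀ b : ℝ, 0 < b → ∀ k : ℕ, 1 ≤ k → ∀ f : ℝ → ℝ,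
      ContDiffOn ℝ 2 f (Set.Icc 0 b) →
      |(1 / Real.Gamma α) * (∫ t in (0 : ℝ)..b, (b - t) ^ (α - 1) * f t) -
          ((b / k) ^ α / Real.Gamma (α + 2)) *
            (((((k : ℝ) - 1) ^ (α + 1) - ((k : ℝ) - α - 1) * (k : ℝ) ^ α) * f 0 + f b) +
              ∑ j ∈ Finset.Icc 1 (k - 1),
                (((k : ℝ) - (j : ℝ) + 1) ^ (α + 1) - 2 * ((k : ℝ) - (j : ℝ)) ^ (α + 1) +
                    ((k : ℝ) - (j : ℝ) - 1) ^ (α + 1)) * f ((j : ℝ) * (b / k)))| ≤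
        c * sSup ((fun t => |iteratedDerivWithin 2 f (Set.Icc 0 b) t|) '' Set.Icc 0 b) *
          b ^ α * (b / k) ^ 2 := by
  have hΓ : 0 < Real.Gamma α := Real.Gamma_pos_of_pos hα
  have hΓ2 : Real.Gamma (α + 2) = α * (α + 1) * Real.Gamma α := by
    rw [show α + 2 = α + 1 + 1 by ring, Real.Gamma_add_one (by positivity),
      Real.Gamma_add_one hα.ne']
    ring
  refine ⟨1 / (Real.Gamma α * α), by positivity, fun b hb k hk f hf => ?_⟩
  set M := sSup ((fun t => |iteratedDerivWithin 2 f (Set.Icc 0 b) t|) '' Set.Icc 0 b) with hMdef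
  have hk0 : (0 : ℝ) < k := by exact_mod_cast hk
  set h := b / k with hh
  have hh0 : 0 < h := by positivity
  have hkh : k * h = b := by rw [hh]; field_simp
  have hM0 : 0 ≤ M := Real.sSup_nonneg (by rintro _ ⟨t, -, rfl⟩; exact abs_nonneg _)
  have hderiv : ∀ t ∈ Set.Ioo 0 b, HasDerivAt f (derivWithin f (Set.Icc 0 b) t) t := fun t ht =>
    ((hf.differentiableOn (by norm_num) t (Set.Ioo_subset_Icc_self ht)).hasDerivWithinAt).hasDerivAt
      (Icc_mem_nhds ht.1 ht.2)
  have hLip := abs_derivWithin_sub_le_of_contDiffOn hb hf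
  have hpanel : ∀ j ∈ Finset.range k,
      0 ≤ (j : ℝ) * h ∧ (j : ℝ) * h + h ≤ b ∧ (1 : ℝ) ≤ (k : ℝ) - j := by
    intro j hj
    have hj : (j : ℝ) + 1 ≤ k := by exact_mod_cast Finset.mem_range.1 hj
    exact ⟨by positivity, by nlinarith, by linarith⟩
  have hnode : ∀ j : ℕ, ((j + 1 : ℕ) : ℝ) * h = j * h + h := fun j => by push_cast; ring
  have hsplit : ∀ g : ℝ → ℝ, ContinuousOn g (Set.Icc 0 b) →
      ∑ j ∈ Finset.range k, ∫ t in (j * h)..(j * h + h), (b - t) ^ (α - 1) * g t =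
        ∫ t in (0 : ℝ)..b, (b - t) ^ (α - 1) * g t := by
    intro g hg
    have := intervalIntegral.sum_integral_adjacent_intervals (μ := MeasureTheory.volume)
      (f := fun t => (b - t) ^ (α - 1) * g t) (a := fun j : ℕ => (j : ℝ) * h) (n := k)
      fun j hj => by
        obtain ⟨h1, h2, -⟩ := hpanel j (Finset.mem_range.2 hj)
        refine intervalIntegrable_sub_rpow_mul hα (hg.mono ?_)
        rw [hnode, Set.uIcc_of_le (by linarith)]
        exact Set.Icc_subset_Icc h1 h2
    simpa only [hnode, hkh, Nat.cast_zero, zero_mul] using this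
  have hT : (h ^ α / Real.Gamma (α + 2)) *
      (((((k : ℝ) - 1) ^ (α + 1) - ((k : ℝ) - α - 1) * (k : ℝ) ^ α) * f 0 + f b) +
        ∑ j ∈ Finset.Icc 1 (k - 1),
          (((k : ℝ) - (j : ℝ) + 1) ^ (α + 1) - 2 * ((k : ℝ) - (j : ℝ)) ^ (α + 1) +
              ((k : ℝ) - (j : ℝ) - 1) ^ (α + 1)) * f ((j : ℝ) * h)) =
      1 / Real.Gamma α * ∑ j ∈ Finset.range k, ∫ t in (j * h)..(j * h + h),
        (b - t) ^ (α - 1) *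
          ((f (j * h) * (j * h + h - t) + f (j * h + h) * (t - j * h)) / (j * h + h - j * h)) := by
    have hw := sum_panel_weights hα hk fun j => f (j * h)
    simp only [Nat.cast_zero, zero_mul, hkh] at hw
    rw [← hw, hΓ2, Finset.mul_sum, Finset.mul_sum]
    refine Finset.sum_congr rfl fun j hj => ?_
    rw [add_sub_cancel_left, integral_sub_rpow_mul_interpolation hα hh0 (hpanel j hj).2.2
      (by rw [sub_mul, hkh]), hnode, sub_right_comm (k : ℝ) j α]
    field_simp
  have hW : ∑ j ∈ Finset.range k, ∫ t in (j * h)..(j * h + h), (b - t) ^ (α - 1) = b ^ α / α := by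
    have := hsplit (fun _ => 1) continuousOn_const
    simp only [mul_one] at this
    rw [this, integral_sub_rpow hα hb.le le_rfl, sub_zero, sub_self, Real.zero_rpow hα.ne',
      sub_zero]
  rw [hT, ← hsplit f hf.continuousOn, ← mul_sub, ← Finset.sum_sub_distrib, abs_mul,
    abs_of_pos (one_div_pos.2 hΓ)]
  calc _ ≤ 1 / Real.Gamma α * ∑ j ∈ Finset.range k,
        M * h ^ 2 * ∫ t in (j * h)..(j * h + h), (b - t) ^ (α - 1) := by
        refine mul_le_mul_of_nonneg_left ((Finset.abs_sum_le_sum_abs _ _).trans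
          (Finset.sum_le_sum fun j hj => ?_)) (one_div_pos.2 hΓ).le
        obtain ⟨h1, h2, -⟩ := hpanel j hj
        have hsub := Set.Icc_subset_Icc h1 h2
        have := abs_integral_sub_rpow_mul_sub_interpolation_le (M := M) hα
          (show (j : ℝ) * h < j * h + h by linarith) h2 (hf.continuousOn.mono hsub)
          (fun t ht => hderiv t ⟨h1.trans_lt ht.1, ht.2.trans_le h2⟩)
          (fun s hs t ht => hLip s (hsub hs) t (hsub ht)) hM0
        rwa [show M * h ^ 2 = M * ((j : ℝ) * h + h - j * h) ^ 2 by ring]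
    _ = _ := by
        rw [← Finset.mul_sum, hW]
        field_simp
end

section
/- Let b > 0, n ∈ ℕ with n ≥ 1, and α with n−1 < α ≤ n. There exists a constant c′_{n−α} > 0, depending only on α, with the following property: for every k ∈ ℕ, k ≥ 1, setting h = b/k and nodes x_j = j·h for j = 0,…,k, and for every f ∈ C^{n+2}[0,b], the modified trapezoidal rule C(f,h,α) = (h^{n−α}/Γ(n+2−α)) · [ ((k−1)^{n−α+1} − (k−n+α−1)·k^{n−α})·f^{(n)}(0) + f^{(n)}(b) + Σ_{j=1}^{k−1} ((k−j+1)^{n−α+1} − 2(k−j)^{n−α+1} + (k−j−1)^{n−α+1})·f^{(n)}(x_j) ] satisfies | (1/Γ(n−α)) ∫₀ᵇ (b−t)^{n−α−1} f^{(n)}(t) dt − C(f,h,α) | ≤ c′_{n−α} · ‖f^{(n+2)}‖_∞ · b^{n−α} · h², where ‖f^{(n+2)}‖_∞ = max_{t∈[0,b]} |f^{(n+2)}(t)|. (In the case α = n the Caputo derivative is understood as f^{(n)}(b) and the bound holds trivially; the substantive case is n−1 < α < n.) -/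
open Real intervalIntegral Set

/-- Crude error bound for linear interpolation of a function whose derivative is `M`-Lipschitz. -/
lemma abs_sub_linear_interpolation_le_s7 {g g' : ℝ → ℝ} {a c t M : ℝ} (hac : a < c)
    (ht : t ∈ Icc a c) (hM : 0 ≤ M) (hg : ContinuousOn g (Icc a c))
    (hd : ∀ x ∈ Ioo a c, HasDerivAt g (g' x) x)
    (hL : ∀ x ∈ Ioo a c, ∀ y ∈ Ioo a c, |g' x - g' y| ≤ M * |x - y|) :
    |g t - (g a * (c - t) + g c * (t - a)) / (c - a)| ≤ M * (c - a) ^ 2 := by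
  have hca : 0 < c - a := sub_pos.2 hac
  rcases ht.1.eq_or_lt with rfl | hat
  · have : g a - (g a * (c - a) + g c * (a - a)) / (c - a) = 0 := by field_simp; ring
    rw [this, abs_zero]
    positivity
  obtain ⟨ξ, hξ, hξe⟩ := exists_hasDerivAt_eq_slope g g' hat
    (hg.mono (Icc_subset_Icc_right ht.2)) fun x hx => hd x ⟨hx.1, hx.2.trans_le ht.2⟩
  obtain ⟨η, hη, hηe⟩ := exists_hasDerivAt_eq_slope g g' hac hg hd
  have hta : 0 < t - a := sub_pos.2 hat
  have hξ' : ξ ∈ Ioo a c := ⟨hξ.1, hξ.2.trans_le ht.2⟩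
  have hrw : g t - (g a * (c - t) + g c * (t - a)) / (c - a) = (g' ξ - g' η) * (t - a) := by
    rw [hξe, hηe]
    field_simp
    ring
  have hdist : |ξ - η| ≤ c - a := by
    rw [abs_le]
    constructor <;> linarith [hξ'.1, hξ'.2, hη.1, hη.2]
  rw [hrw, abs_mul, abs_of_pos hta]
  calc |g' ξ - g' η| * (t - a) ≤ (M * (c - a)) * (c - a) := by
        gcongr
        · exact (hL ξ hξ' η hη).trans (by gcongr)
        · exact ht.2
    _ = M * (c - a) ^ 2 := by ring

lemma intervalIntegrable_sub_rpow_s7 {s : ℝ} (hs : 0 < s) (b x y : ℝ) :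
    IntervalIntegrable (fun t : ℝ => (b - t) ^ (s - 1)) MeasureTheory.volume x y := by
  have h := (intervalIntegrable_rpow' (a := b - x) (b := b - y) (r := s - 1)
    (by linarith)).comp_sub_left b
  simpa using h

lemma integral_sub_rpow_s7 {s : ℝ} (hs : 0 < s) (b : ℝ) :
    ∫ t in (0 : ℝ)..b, (b - t) ^ (s - 1) = b ^ s / s := by
  rw [integral_comp_sub_left (fun u : ℝ => u ^ (s - 1)) b, integral_rpow (Or.inl (by linarith))]
  simp [Real.zero_rpow hs.ne']

/-- Exact integral of a linear interpolant against the Abel kernel over one mesh cell. -/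
lemma integral_sub_rpow_mul_linear {s h p b a c : ℝ} (hs : 0 < s) (hh : 0 < h) (hp : 1 ≤ p)
    (ha : b - a = h * p) (hc : b - c = h * (p - 1)) (G₀ G₁ : ℝ) :
    ∫ t in a..c, (b - t) ^ (s - 1) * ((G₀ * (c - t) + G₁ * (t - a)) / (c - a)) =
      h ^ s / (s * (s + 1)) *
        (((p - 1) ^ (s + 1) - p ^ (s + 1) + (s + 1) * p ^ s) * G₀ +
          (p ^ (s + 1) - (p - 1) ^ (s + 1) - (s + 1) * (p - 1) ^ s) * G₁) := by
  have hca : c - a = h := by linarith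
  have hp0 : 0 ≤ p - 1 := by linarith
  have hsub := integral_comp_sub_left (a := a) (b := c)
    (fun u : ℝ => u ^ (s - 1) * ((G₀ * (u - h * (p - 1)) + G₁ * (h * p - u)) / h)) b
  have hleft : ∀ t : ℝ, (b - t) ^ (s - 1) * ((G₀ * (c - t) + G₁ * (t - a)) / (c - a)) =
      (b - t) ^ (s - 1) * ((G₀ * (b - t - h * (p - 1)) + G₁ * (h * p - (b - t))) / h) := by
    intro t
    rw [hca, ← ha, ← hc]
    ring
  simp_rw [hleft]
  rw [hsub, ha, hc]
  have hcongr : ∫ u in (h * (p - 1))..(h * p),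
        u ^ (s - 1) * ((G₀ * (u - h * (p - 1)) + G₁ * (h * p - u)) / h) =
      ∫ u in (h * (p - 1))..(h * p),
        ((G₀ - G₁) / h * u ^ s + (G₁ * p - G₀ * (p - 1)) * u ^ (s - 1)) := by
    refine integral_congr fun u hu => ?_
    rw [uIcc_of_le (by nlinarith)] at hu
    have hu0 : 0 ≤ u := (by positivity : 0 ≤ h * (p - 1)).trans hu.1
    have hus : u ^ s = u ^ (s - 1) * u := by
      rcases hu0.eq_or_lt with rfl | hu0
      · simp [Real.zero_rpow hs.ne']
      · rw [Real.rpow_sub_one hu0.ne']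
        field_simp
    simp only [hus]
    field_simp
    ring
  have hi₁ := intervalIntegrable_rpow' (a := h * (p - 1)) (b := h * p) (r := s) (by linarith)
  have hi₂ := intervalIntegrable_rpow' (a := h * (p - 1)) (b := h * p) (r := s - 1) (by linarith)
  rw [hcongr, integral_add (hi₁.const_mul _) (hi₂.const_mul _), integral_const_mul,
    integral_const_mul, integral_rpow (Or.inl (by linarith)), integral_rpow (Or.inl (by linarith)),
    sub_add_cancel]
  have hsucc : ∀ x : ℝ, 0 ≤ x → x ^ (s + 1) = x ^ s * x := fun x hx => by
    rw [Real.rpow_add' hx (by linarith), Real.rpow_one]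
  rw [hsucc _ (by positivity), hsucc _ (by positivity), hsucc p (by linarith), hsucc _ hp0,
    Real.mul_rpow hh.le (by linarith), Real.mul_rpow hh.le hp0]
  field_simp
  ring

/-- Summation of cellwise weights into nodal weights. -/
lemma sum_cell_weights_eq_nodal_weights {s : ℝ} (hs : 0 < s) {k : ℕ} (hk : 1 ≤ k) (G : ℕ → ℝ) :
    ∑ j ∈ Finset.range k,
        ((((k : ℝ) - j - 1) ^ (s + 1) - ((k : ℝ) - j) ^ (s + 1)
            + (s + 1) * ((k : ℝ) - j) ^ s) * G j +
          (((k : ℝ) - j) ^ (s + 1) - ((k : ℝ) - j - 1) ^ (s + 1)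
            - (s + 1) * ((k : ℝ) - j - 1) ^ s) * G (j + 1)) =
      ((((k : ℝ) - 1) ^ (s + 1) - ((k : ℝ) - s - 1) * (k : ℝ) ^ s) * G 0 + G k) +
        ∑ j ∈ Finset.Icc 1 (k - 1),
          (((k : ℝ) - j + 1) ^ (s + 1) - 2 * ((k : ℝ) - j) ^ (s + 1)
            + ((k : ℝ) - j - 1) ^ (s + 1)) * G j := by
  obtain ⟨m, rfl⟩ : ∃ m, k = m + 1 := ⟨k - 1, by omega⟩
  have hIcc : Finset.Icc 1 (m + 1 - 1) = Finset.Ico 1 (m + 1) := by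
    ext; simp only [Finset.mem_Icc, Finset.mem_Ico]; omega
  have hK : ((m + 1 : ℕ) : ℝ) ^ (s + 1) = ((m + 1 : ℕ) : ℝ) ^ s * ((m + 1 : ℕ) : ℝ) := by
    rw [Real.rpow_add' (by positivity) (by linarith), Real.rpow_one]
  have hlast : ((m + 1 : ℕ) : ℝ) - m = 1 := by push_cast; ring
  rw [Finset.sum_add_distrib, Finset.sum_range_succ', Finset.sum_range_succ, hIcc,
    Finset.sum_Ico_eq_sum_range, hlast, Nat.cast_zero, sub_zero, hK, sub_self, Real.one_rpow,
    Real.zero_rpow hs.ne', Real.zero_rpow (by linarith : s + 1 ≠ 0)]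
  have hsum : ∑ j ∈ Finset.range (m + 1 - 1),
        ((((m + 1 : ℕ) : ℝ) - (1 + j : ℕ) + 1) ^ (s + 1)
          - 2 * (((m + 1 : ℕ) : ℝ) - (1 + j : ℕ)) ^ (s + 1)
          + (((m + 1 : ℕ) : ℝ) - (1 + j : ℕ) - 1) ^ (s + 1)) * G (1 + j) =
      ∑ j ∈ Finset.range m,
        ((((m + 1 : ℕ) : ℝ) - (j + 1 : ℕ) - 1) ^ (s + 1) - (((m + 1 : ℕ) : ℝ) - (j + 1 : ℕ)) ^ (s + 1)
            + (s + 1) * (((m + 1 : ℕ) : ℝ) - (j + 1 : ℕ)) ^ s) * G (j + 1) +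
      ∑ j ∈ Finset.range m,
          ((((m + 1 : ℕ) : ℝ) - j) ^ (s + 1) - (((m + 1 : ℕ) : ℝ) - j - 1) ^ (s + 1)
            - (s + 1) * (((m + 1 : ℕ) : ℝ) - j - 1) ^ s) * G (j + 1) := by
    rw [← Finset.sum_add_distrib]
    refine Finset.sum_congr rfl fun j _ => ?_
    have e₁ : ((m + 1 : ℕ) : ℝ) - (1 + j : ℕ) + 1 = ((m + 1 : ℕ) : ℝ) - j := by push_cast; ring
    have e₂ : ((m + 1 : ℕ) : ℝ) - (1 + j : ℕ) = ((m + 1 : ℕ) : ℝ) - j - 1 := by push_cast; ring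
    rw [e₁, add_comm j 1, e₂]
    ring
  rw [hsum]
  ring

/-- Error of the product trapezoidal rule for the Abel kernel `(b - t) ^ (s - 1)`. -/
lemma abs_integral_sub_product_trapezoidal_le {s b M : ℝ} (hs : 0 < s) (hb : 0 < b) (hM : 0 ≤ M)
    {k : ℕ} (hk : 1 ≤ k) {g g' : ℝ → ℝ} (hg : ContinuousOn g (Icc 0 b))
    (hd : ∀ x ∈ Ioo 0 b, HasDerivAt g (g' x) x)
    (hL : ∀ x ∈ Ioo 0 b, ∀ y ∈ Ioo 0 b, |g' x - g' y| ≤ M * |x - y|) :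
    |(∫ t in (0 : ℝ)..b, (b - t) ^ (s - 1) * g t) -
        (b / k) ^ s / (s * (s + 1)) *
          (((((k : ℝ) - 1) ^ (s + 1) - ((k : ℝ) - s - 1) * (k : ℝ) ^ s) * g 0 + g b) +
            ∑ j ∈ Finset.Icc 1 (k - 1),
              (((k : ℝ) - j + 1) ^ (s + 1) - 2 * ((k : ℝ) - j) ^ (s + 1)
                + ((k : ℝ) - j - 1) ^ (s + 1)) * g ((j : ℝ) * (b / k)))| ≤
      M * (b / k) ^ 2 * (b ^ s / s) := by
  have hk0 : (0 : ℝ) < k := by exact_mod_cast hk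
  set h : ℝ := b / k with hh_def
  have hh : 0 < h := by positivity
  have hkh : (k : ℝ) * h = b := by rw [hh_def]; field_simp
  let x : ℕ → ℝ := fun j => (j : ℝ) * h
  have hx0 : x 0 = 0 := by simp [x]
  have hxk : x k = b := hkh
  have hstep : ∀ j, x (j + 1) - x j = h := fun j => by simp only [x]; push_cast; ring
  have hlt : ∀ j, x j < x (j + 1) := fun j => by linarith [hstep j]
  have hx_nonneg : ∀ j, 0 ≤ x j := fun j => by positivity
  have hx_le : ∀ j < k, x (j + 1) ≤ b := fun j hj => by
    rw [← hkh]
    exact mul_le_mul_of_nonneg_right (by exact_mod_cast hj) hh.le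
  have hsub : ∀ j < k, Icc (x j) (x (j + 1)) ⊆ Icc 0 b := fun j hj =>
    Icc_subset_Icc (hx_nonneg j) (hx_le j hj)
  have hsub' : ∀ j < k, Ioo (x j) (x (j + 1)) ⊆ Ioo 0 b := fun j hj =>
    Ioo_subset_Ioo (hx_nonneg j) (hx_le j hj)
  let L : ℕ → ℝ → ℝ := fun j t =>
    (g (x j) * (x (j + 1) - t) + g (x (j + 1)) * (t - x j)) / (x (j + 1) - x j)
  have hw := intervalIntegrable_sub_rpow_s7 hs b
  have hwg : ∀ j < k, IntervalIntegrable (fun t => (b - t) ^ (s - 1) * g t)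
      MeasureTheory.volume (x j) (x (j + 1)) := fun j hj =>
    (hw _ _).mul_continuousOn (by
      rw [uIcc_of_le (hlt j).le]
      exact hg.mono (hsub j hj))
  have hwL : ∀ j, IntervalIntegrable (fun t => (b - t) ^ (s - 1) * L j t)
      MeasureTheory.volume (x j) (x (j + 1)) := fun j =>
    (hw _ _).mul_continuousOn (by
      refine Continuous.continuousOn ?_
      simp only [L]
      fun_prop)
  have hrule : h ^ s / (s * (s + 1)) *
      (((((k : ℝ) - 1) ^ (s + 1) - ((k : ℝ) - s - 1) * (k : ℝ) ^ s) * g 0 + g b) +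
        ∑ j ∈ Finset.Icc 1 (k - 1),
          (((k : ℝ) - j + 1) ^ (s + 1) - 2 * ((k : ℝ) - j) ^ (s + 1)
            + ((k : ℝ) - j - 1) ^ (s + 1)) * g ((j : ℝ) * h)) =
      ∑ j ∈ Finset.range k, ∫ t in x j..x (j + 1), (b - t) ^ (s - 1) * L j t := by
    have hnodal := sum_cell_weights_eq_nodal_weights hs hk fun j => g (x j)
    rw [hx0, hxk] at hnodal
    rw [← hnodal, Finset.mul_sum]
    refine Finset.sum_congr rfl fun j hj => ?_
    have hj' : (j : ℝ) + 1 ≤ k := by exact_mod_cast Finset.mem_range.1 hj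
    refine (integral_sub_rpow_mul_linear hs hh (p := (k : ℝ) - j) (by linarith) ?_ ?_ _ _).symm
    · rw [← hkh]; simp only [x]; ring
    · rw [← hkh]; simp only [x]; push_cast; ring
  have hcell : ∀ j ∈ Finset.range k,
      |(∫ t in x j..x (j + 1), (b - t) ^ (s - 1) * g t) -
          ∫ t in x j..x (j + 1), (b - t) ^ (s - 1) * L j t| ≤
        ∫ t in x j..x (j + 1), M * h ^ 2 * (b - t) ^ (s - 1) := by
    intro j hj
    have hj := Finset.mem_range.1 hj
    rw [← integral_sub (hwg j hj) (hwL j), ← Real.norm_eq_abs]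
    refine norm_integral_le_of_norm_le (hlt j).le (.of_forall fun t ht => ?_)
      ((hw _ _).const_mul _)
    have ht : t ∈ Icc (x j) (x (j + 1)) := Ioc_subset_Icc_self ht
    have hpos : 0 ≤ (b - t) ^ (s - 1) := Real.rpow_nonneg (sub_nonneg.2 (hsub j hj ht).2) _
    rw [← mul_sub, Real.norm_eq_abs, abs_mul, abs_of_nonneg hpos, mul_comm]
    refine mul_le_mul_of_nonneg_right ?_ hpos
    have := abs_sub_linear_interpolation_le_s7 (hlt j) ht hM (hg.mono (hsub j hj))
      (fun y hy => hd y (hsub' j hj hy))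
      (fun y hy z hz => hL y (hsub' j hj hy) z (hsub' j hj hz))
    simp only [L]
    rwa [hstep] at this ⊢
  have hsplit := sum_integral_adjacent_intervals hwg
  have hsplit' := sum_integral_adjacent_intervals (n := k) fun j _ =>
    (hw (x j) (x (j + 1))).const_mul (M * h ^ 2)
  rw [hx0, hxk] at hsplit hsplit'
  rw [hrule, ← hsplit, ← Finset.sum_sub_distrib]
  calc _ ≤ _ := Finset.abs_sum_le_sum_abs _ _
    _ ≤ _ := Finset.sum_le_sum hcell
    _ = _ := by rw [hsplit', integral_const_mul, integral_sub_rpow_s7 hs]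

/-- (Odibat's modified trapezoidal rule for the Caputo fractional derivative.)
Let `b > 0`, `n ≥ 1` and `n - 1 < α ≤ n`. There is a constant `c > 0`, depending only on
`α`, such that for every `b > 0`, every `k ≥ 1` (step `h = b/k`, nodes `x_j = j*h`) and
every `f ∈ C^{n+2}[0,b]`, the modified trapezoidal rule `C(f,h,α)` approximates the Caputo
fractional derivative `(1/Γ (n-α)) ∫ t in 0..b, (b - t)^(n-α-1) * f^{(n)} t` (understood as
`f^{(n)} b` in the degenerate case `α = n`) with error at most
`c * ‖f^{(n+2)}‖_∞ * b^(n-α) * h²`. -/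
theorem modified_trapezoidal_rule_caputo_derivative
    (n : ℕ) (hn : 1 ≤ n) (α : ℝ) (hα1 : (n : ℝ) - 1 < α) (hα2 : α ≤ n) :
    ∃ c > 0, ∀ b : ℝ, 0 < b → ∀ k : ℕ, 1 ≤ k → ∀ f : ℝ → ℝ,
      ContDiffOn ℝ (n + 2) f (Set.Icc 0 b) →
      |(if α < n then
            (1 / Real.Gamma ((n : ℝ) - α)) *
              ∫ t in (0 : ℝ)..b, (b - t) ^ ((n : ℝ) - α - 1) *
                iteratedDerivWithin n f (Set.Icc 0 b) t
          else iteratedDerivWithin n f (Set.Icc 0 b) b) -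
          ((b / k) ^ ((n : ℝ) - α) / Real.Gamma ((n : ℝ) + 2 - α)) *
            (((((k : ℝ) - 1) ^ ((n : ℝ) - α + 1) -
                  ((k : ℝ) - (n : ℝ) + α - 1) * (k : ℝ) ^ ((n : ℝ) - α)) *
                  iteratedDerivWithin n f (Set.Icc 0 b) 0 +
                iteratedDerivWithin n f (Set.Icc 0 b) b) +
              ∑ j ∈ Finset.Icc 1 (k - 1),
                (((k : ℝ) - (j : ℝ) + 1) ^ ((n : ℝ) - α + 1) -
                    2 * ((k : ℝ) - (j : ℝ)) ^ ((n : ℝ) - α + 1) +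
                    ((k : ℝ) - (j : ℝ) - 1) ^ ((n : ℝ) - α + 1)) *
                  iteratedDerivWithin n f (Set.Icc 0 b) ((j : ℝ) * (b / k)))| ≤
        c * sSup ((fun t => |iteratedDerivWithin (n + 2) f (Set.Icc 0 b) t|) '' Set.Icc 0 b) *
          b ^ ((n : ℝ) - α) * (b / k) ^ 2 := by
  have hnonneg : ∀ (b : ℝ) (f : ℝ → ℝ),
      0 ≤ sSup ((fun t => |iteratedDerivWithin (n + 2) f (Set.Icc 0 b) t|) '' Set.Icc 0 b) :=
    fun b f => Real.sSup_nonneg (by rintro _ ⟨t, _, rfl⟩; exact abs_nonneg _)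
  obtain ⟨s, hs⟩ : ∃ s, s = (n : ℝ) - α := ⟨_, rfl⟩
  have e₁ : (n : ℝ) + 2 - α = s + 2 := by rw [hs]; ring
  have e₂ : ∀ k : ℕ, (k : ℝ) - (n : ℝ) + α - 1 = k - s - 1 := fun k => by rw [hs]; ring
  simp only [e₁, e₂, ← hs]
  rcases hα2.eq_or_lt with hα | hα
  · obtain rfl : s = 0 := by rw [hs, hα, sub_self]
    refine ⟨1, one_pos, fun b hb k hk f hf => ?_⟩
    have hΓ : Real.Gamma 2 = 1 := Real.Gamma_two
    have hz : ∀ j : ℝ, (k : ℝ) - j + 1 - 2 * (k - j) + (k - j - 1) = 0 := fun j => by ring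
    have := hnonneg b f
    simp only [hα, lt_irrefl, if_false, zero_add, Real.rpow_zero, Real.rpow_one, hΓ, hz, zero_mul,
      Finset.sum_const_zero, sub_zero, mul_one, sub_self, add_zero, div_one, one_mul, abs_zero]
    positivity
  · have hs0 : 0 < s := by rw [hs]; linarith
    have hΓ : 0 < Real.Gamma s := Real.Gamma_pos_of_pos hs0
    refine ⟨1 / (s * Real.Gamma s), by positivity, fun b hb k hk f hf => ?_⟩
    have hΓ₂ : Real.Gamma (s + 2) = s * (s + 1) * Real.Gamma s := by
      rw [show s + 2 = s + 1 + 1 by ring, Real.Gamma_add_one (by linarith),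
        Real.Gamma_add_one hs0.ne']
      ring
    have hu : UniqueDiffOn ℝ (Icc 0 b) := uniqueDiffOn_Icc hb
    set M := sSup ((fun t => |iteratedDerivWithin (n + 2) f (Set.Icc 0 b) t|) '' Set.Icc 0 b)
      with hM_def
    have hcont : ContinuousOn (iteratedDerivWithin (n + 2) f (Icc 0 b)) (Icc 0 b) :=
      hf.continuousOn_iteratedDerivWithin (by norm_cast) hu
    have hM : ∀ t ∈ Icc 0 b, |iteratedDerivWithin (n + 2) f (Icc 0 b) t| ≤ M := fun t ht =>
      le_csSup (isCompact_Icc.image_of_continuousOn hcont.abs).bddAbove ⟨t, ht, rfl⟩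
    have hdiff : ∀ m < n + 2,
        DifferentiableOn ℝ (iteratedDerivWithin m f (Icc 0 b)) (Icc 0 b) := fun m hm =>
      hf.differentiableOn_iteratedDerivWithin (by exact_mod_cast hm) hu
    have hderiv : ∀ x ∈ Ioo 0 b, HasDerivAt (iteratedDerivWithin n f (Icc 0 b))
        (iteratedDerivWithin (n + 1) f (Icc 0 b) x) x := fun x hx => by
      rw [iteratedDerivWithin_succ]
      exact ((hdiff n (by omega)) x (Ioo_subset_Icc_self hx)).hasDerivWithinAt.hasDerivAt
        (Icc_mem_nhds hx.1 hx.2)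
    have hLip : ∀ x ∈ Ioo 0 b, ∀ y ∈ Ioo 0 b, |iteratedDerivWithin (n + 1) f (Icc 0 b) x -
        iteratedDerivWithin (n + 1) f (Icc 0 b) y| ≤ M * |x - y| := fun x hx y hy =>
      (convex_Icc 0 b).norm_image_sub_le_of_norm_derivWithin_le (hdiff (n + 1) (by omega))
        (fun t ht => by
          rw [← iteratedDerivWithin_succ]
          exact hM t ht)
        (Ioo_subset_Icc_self hy) (Ioo_subset_Icc_self hx)
    have key := abs_integral_sub_product_trapezoidal_le hs0 hb (hnonneg b f) hk
      (hdiff n (by omega)).continuousOn hderiv hLip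
    rw [if_pos hα, hΓ₂]
    rw [← hM_def] at key
    have hfactor : ∀ I R : ℝ, 1 / Real.Gamma s * I -
        (b / k) ^ s / (s * (s + 1) * Real.Gamma s) * R =
        1 / Real.Gamma s * (I - (b / k) ^ s / (s * (s + 1)) * R) := fun I R => by
      field_simp
    rw [hfactor, abs_mul, abs_of_pos (by positivity : 0 < 1 / Real.Gamma s)]
    refine (mul_le_mul_of_nonneg_left key (by positivity)).trans_eq ?_
    field_simp
end
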